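/- Let (W,S) be a Coxeter system of rank 3 with S = {r,s,t}, in which rt = tr (the product rt has order 2), the order of st equals 3, and the order m_{sr} of sr satisfies m_{sr} ≥ 7 (possibly infinite). Then there is no element w of W admitting elements w₁, w₂ ∈ W with w = w₁·s·r·s, ℓ(w) = ℓ(w₁) + 3, and w = w₂·t, ℓ(w) = ℓ(w₂) + 1. -/

import Mathlib

namespace CoxeterSystem

variable {B W : Type*} [Group W] {M : CoxeterMatrix B} (cs : CoxeterSystem M W)

theorem functionEnd_mul_apply {α : Type*} (f g : Function.End α) (a : α) : (f * g) a = f (g a) := rfl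

open Classical in
/-- The map `(x, ε) ↦ (sᵢ x sᵢ, ε + [x = sᵢ])`; these maps generate the action of `W` on signed
reflections. -/
noncomputable def signedConj (i : B) : Function.End (W × ZMod 2) := fun p ↦
  (cs.simple i * p.1 * cs.simple i, p.2 + if p.1 = cs.simple i then 1 else 0)

open Classical in
theorem signedConj_mul_pow_apply (i j : B) (n : ℕ) (x : W) (ε : ZMod 2) :
    ((cs.signedConj i * cs.signedConj j) ^ n) (x, ε) =
      ((cs.simple i * cs.simple j) ^ n * x * ((cs.simple i * cs.simple j) ^ n)⁻¹,
        ε + ∑ a ∈ Finset.range (2 * n),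
          if x = cs.simple j * (cs.simple i * cs.simple j) ^ a then 1 else 0) := by
  induction n with
  | zero => simp [Function.End.one_def]
  | succ n ih =>
    rw [pow_succ', functionEnd_mul_apply, ih]
    generalize hc : cs.simple i * cs.simple j = c
    have hij : cs.simple i = c * cs.simple j := by simp [← hc]
    have hcj : cs.simple j * c * cs.simple j = c⁻¹ := by simp [← hc, mul_assoc]
    have hpow (l : ℕ) : cs.simple j * c ^ l = (c ^ l)⁻¹ * cs.simple j := by
      rw [← inv_pow, ← hcj]
      induction l with
      | zero => simp
      | succ l ihl => rw [pow_succ, ← mul_assoc, ihl, pow_succ]; simp [mul_assoc]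
    have h1 : c ^ n * x * (c ^ n)⁻¹ = cs.simple j ↔ x = cs.simple j * c ^ (2 * n) := by
      rw [two_mul, pow_add, ← mul_assoc, hpow]
      constructor
      · intro h; rw [← h]; group
      · rintro rfl; group
    have h2 : cs.simple j * (c ^ n * x * (c ^ n)⁻¹) * cs.simple j = cs.simple i ↔
        x = cs.simple j * c ^ (2 * n + 1) := by
      have e : cs.simple j * c ^ (2 * n + 1) = (c ^ n)⁻¹ * (cs.simple j * c) * c ^ n := by
        rw [show 2 * n + 1 = n + (1 + n) by omega, pow_add, pow_add, ← mul_assoc, hpow, pow_one]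
        group
      rw [e, hij]
      constructor
      · intro h
        have h' : c ^ n * x * (c ^ n)⁻¹ = cs.simple j * c := by
          have := congrArg (fun y ↦ cs.simple j * y * cs.simple j) h
          simpa [mul_assoc] using this
        rw [← h']; group
      · rintro rfl
        have : c ^ n * ((c ^ n)⁻¹ * (cs.simple j * c) * c ^ n) * (c ^ n)⁻¹ = cs.simple j * c := by
          group
        rw [this]; simp
    rw [show 2 * (n + 1) = 2 * n + 1 + 1 by omega, Finset.sum_range_succ, Finset.sum_range_succ]
    simp only [functionEnd_mul_apply, signedConj, h1, h2]
    refine Prod.ext ?_ ?_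
    · have : c⁻¹ = cs.simple j * cs.simple i := by simp [← hc]
      simp only [pow_succ', mul_inv_rev, this]
      simp only [← hc, mul_assoc]
    · simp only [add_assoc]

theorem isLiftable_signedConj : M.IsLiftable cs.signedConj := by
  classical
  intro i j
  funext ⟨x, ε⟩
  rw [signedConj_mul_pow_apply, two_mul, Finset.sum_range_add]
  simp [pow_add, CharTwo.add_self_eq_zero, Function.End.one_def]

open Classical in
theorem lift_signedConj_wordProd (ω : List B) (x : W) (ε : ZMod 2) :
    cs.lift ⟨cs.signedConj, cs.isLiftable_signedConj⟩ (cs.wordProd ω) (x, ε) =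
      (cs.wordProd ω * x * (cs.wordProd ω)⁻¹, ε + ((cs.rightInvSeq ω).count x : ℕ)) := by
  induction ω with
  | nil => simp [Function.End.one_def]
  | cons i ω ih =>
    rw [wordProd_cons, map_mul, functionEnd_mul_apply, ih, lift_apply_simple]
    have h : cs.wordProd ω * x * (cs.wordProd ω)⁻¹ = cs.simple i ↔
        (cs.wordProd ω)⁻¹ * cs.simple i * cs.wordProd ω = x := by
      constructor
      · intro h; rw [← h]; group
      · rintro rfl; group
    simp only [signedConj, rightInvSeq, List.count_cons, h, beq_iff_eq]
    refine Prod.ext ?_ ?_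
    · simp [mul_assoc]
    · simp [add_assoc]

/-- The exchange property: a right descent of `w` occurs in the right inversion sequence of every
word for `w`. -/
theorem IsRightDescent.simple_mem_rightInvSeq {cs : CoxeterSystem M W} {ω : List B} {i : B}
    (h : cs.IsRightDescent (cs.wordProd ω) i) : cs.simple i ∈ cs.rightInvSeq ω := by
  classical
  obtain ⟨ω', hω', hw⟩ := cs.exists_isReduced (cs.wordProd ω * cs.simple i)
  have hprod : cs.wordProd (ω'.concat i) = cs.wordProd ω := by
    rw [wordProd_concat, ← hw]; simp
  have hred : cs.IsReduced (ω'.concat i) := by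
    have h1 := cs.isRightDescent_iff.mp h
    rw [IsReduced, hprod, ← h1, hw, hω'.eq, List.length_concat]
  have hcount : (cs.rightInvSeq (ω'.concat i)).count (cs.simple i) = 1 :=
    List.count_eq_one_of_mem hred.nodup_rightInvSeq (by rw [rightInvSeq_concat]; simp)
  have h1 := cs.lift_signedConj_wordProd ω (cs.simple i) 0
  rw [← hprod, lift_signedConj_wordProd, hcount] at h1
  by_contra hmem
  have h2 := congrArg Prod.snd h1
  simp [List.count_eq_zero_of_not_mem hmem] at h2

theorem exists_eq_of_mem_rightInvSeq_alternatingWord {i j : B} {k : ℕ} {x : W}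
    (hx : x ∈ cs.rightInvSeq (alternatingWord i j k)) :
    ∃ q < k, x = cs.simple j * (cs.simple i * cs.simple j) ^ q := by
  induction k generalizing i j x with
  | zero => simp [alternatingWord] at hx
  | succ k ih =>
    rw [alternatingWord_succ, rightInvSeq_concat] at hx
    simp only [List.concat_eq_append, List.mem_append, List.mem_map, List.mem_singleton] at hx
    rcases hx with ⟨y, hy, rfl⟩ | rfl
    · obtain ⟨q, hq, rfl⟩ := ih hy
      refine ⟨q + 1, by omega, ?_⟩
      simp only [MulAut.conj_apply, inv_simple, mul_assoc]
      rw [← mul_pow_mul, pow_succ']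
      simp only [mul_assoc]
    · exact ⟨0, by omega, by simp⟩

/-- An element with right descents `i` and `j` has a reduced word ending in the alternating word
in `i, j` of any length up to the order of `sᵢ sⱼ`. -/
theorem exists_isReduced_append_alternatingWord {w : W} {i j : B} {k : ℕ}
    (hi : cs.IsRightDescent w i) (hj : cs.IsRightDescent w j)
    (hk : ∀ q, 0 < q → q < k → (cs.simple i * cs.simple j) ^ q ≠ 1) :
    ∃ ω, cs.IsReduced (ω ++ alternatingWord i j k) ∧
      w = cs.wordProd (ω ++ alternatingWord i j k) := by
  induction k generalizing i j with
  | zero => simpa [alternatingWord] using cs.exists_isReduced w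
  | succ k ih =>
    have hinv (q : ℕ) (h : (cs.simple j * cs.simple i) ^ q = 1) :
        (cs.simple i * cs.simple j) ^ q = 1 := by
      rw [← inv_inj, ← inv_pow]; simpa using h
    obtain ⟨ω, hω, rfl⟩ := ih hj hi fun q h0 hq h ↦ hk q h0 (by omega) (hinv q h)
    have hmem := hj.simple_mem_rightInvSeq
    obtain ⟨p, hp, hpj⟩ := List.getElem_of_mem hmem
    rw [length_rightInvSeq, List.length_append, length_alternatingWord] at hp
    rcases lt_or_ge p ω.length with hlt | hge
    · have herase := cs.wordProd_mul_getD_rightInvSeq (ω ++ alternatingWord j i k) p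
      rw [List.getD_eq_getElem _ _ (by simpa using hp), hpj,
        List.eraseIdx_append_of_lt_length hlt] at herase
      have hprod : cs.wordProd (ω ++ alternatingWord j i k) =
          cs.wordProd (ω.eraseIdx p ++ alternatingWord i j (k + 1)) := by
        rw [alternatingWord_succ, List.concat_eq_append, ← List.append_assoc,
          cs.wordProd_append _ [j], ← herase]
        simp
      refine ⟨ω.eraseIdx p, ?_, hprod⟩
      rw [IsReduced, ← hprod, hω.eq]
      simp only [List.length_append, length_alternatingWord, List.length_eraseIdx_of_lt hlt]
      omega
    · have hmem' : cs.simple j ∈ cs.rightInvSeq (alternatingWord j i k) := by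
        have hdrop := cs.rightInvSeq_drop (ω ++ alternatingWord j i k) ω.length
        rw [List.drop_left] at hdrop
        rw [hdrop, List.mem_iff_getElem]
        refine ⟨p - ω.length, by simp; omega, ?_⟩
        simp only [List.getElem_drop, ← hpj]
        congr 1; omega
      obtain ⟨q, hq, hqj⟩ := cs.exists_eq_of_mem_rightInvSeq_alternatingWord hmem'
      refine absurd (hinv (q + 1) ?_) (hk (q + 1) (by omega) (by omega))
      rw [pow_succ', mul_assoc, ← hqj]
      simp

theorem exists_eq_mul_wordProd_alternatingWord {w : W} {i j : B} {k : ℕ}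
    (hi : cs.IsRightDescent w i) (hj : cs.IsRightDescent w j)
    (hk : orderOf (cs.simple i * cs.simple j) = 0 ∨ k ≤ orderOf (cs.simple i * cs.simple j)) :
    ∃ x, w = x * cs.wordProd (alternatingWord i j k) ∧ cs.length w = cs.length x + k := by
  obtain ⟨ω, hω, hw⟩ := cs.exists_isReduced_append_alternatingWord (k := k) hi hj
    fun q h0 hq h ↦ by
      have := orderOf_le_of_pow_eq_one h0 h
      have := orderOf_pos_iff.mpr (isOfFinOrder_iff_pow_eq_one.mpr ⟨q, h0, h⟩)
      omega
  refine ⟨cs.wordProd ω, by rw [hw, wordProd_append], ?_⟩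
  have hred : cs.IsReduced ω := by simpa using hω.take ω.length
  rw [hw, hω.eq, hred.eq, List.length_append, length_alternatingWord]

/-- A reduced word ending in `s, r, s` excludes the right descent `t` when `rt`, `st`, `sr` have
orders `2`, `3` and at least `6` (or infinite). -/
theorem not_isRightDescent_of_eq_mul_simple_mul_simple_mul_simple {r s t : B}
    (hrt : orderOf (cs.simple r * cs.simple t) = 2)
    (hst : orderOf (cs.simple s * cs.simple t) = 3)
    (hsr : orderOf (cs.simple s * cs.simple r) = 0 ∨ 6 ≤ orderOf (cs.simple s * cs.simple r))
    {w w₁ : W} (hw : w = w₁ * cs.simple s * cs.simple r * cs.simple s)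
    (hlen : cs.length w = cs.length w₁ + 3) : ¬ cs.IsRightDescent w t := by
  induction hn : cs.length w using Nat.strong_induction_on generalizing w w₁ with
  | _ n ih =>
  subst hn
  intro ht
  have orderOf_comm (i j : B) :
      orderOf (cs.simple j * cs.simple i) = orderOf (cs.simple i * cs.simple j) := by
    rw [← orderOf_inv]; simp
  have hcomm : cs.simple r * cs.simple t = cs.simple t * cs.simple r := by
    have h := pow_orderOf_eq_one (cs.simple r * cs.simple t)
    rw [hrt, pow_two] at h
    simpa using eq_inv_of_mul_eq_one_left h
  -- Each of `w`, `w₁sr`, `w₁s`, `us` and `yt` below has two right descents, which splits off the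
  -- corresponding alternating word; the last one yields a shorter counterexample `zt`.
  have hp : w * cs.simple s = w₁ * cs.simple s * cs.simple r := by rw [hw]; simp
  have hw₁s := cs.length_mul_simple w₁ s
  have hw₁sr := cs.length_mul_simple (w₁ * cs.simple s) r
  have hw₁srs := cs.length_mul_simple (w₁ * cs.simple s * cs.simple r) s
  rw [← hw] at hw₁srs
  obtain ⟨u, hu, hlu⟩ := cs.exists_eq_mul_wordProd_alternatingWord (i := t) (j := s) (k := 3) ht
    (by rw [isRightDescent_iff, hp]; omega) (by rw [orderOf_comm, hst]; simp)
  simp only [alternatingWord, List.concat_eq_append, List.nil_append, List.cons_append,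
    wordProd_cons, wordProd_nil, mul_one, ← mul_assoc] at hu
  have hpu : w₁ * cs.simple s * cs.simple r = u * cs.simple s * cs.simple t := by
    rw [← hp, hu]; simp
  have hus := cs.length_mul_simple u s
  have hust := cs.length_mul_simple (u * cs.simple s) t
  rw [← hpu] at hust
  obtain ⟨v, hv, hlv⟩ := cs.exists_eq_mul_wordProd_alternatingWord (i := t) (j := r) (k := 2)
    (w := w₁ * cs.simple s * cs.simple r)
    (by rw [isRightDescent_iff, hpu, simple_mul_simple_cancel_right, ← hpu]; omega)
    (by rw [isRightDescent_iff, simple_mul_simple_cancel_right]; omega)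
    (by rw [orderOf_comm, hrt]; simp)
  simp only [alternatingWord, List.concat_eq_append, List.nil_append, List.cons_append,
    wordProd_cons, wordProd_nil, mul_one, ← mul_assoc] at hv
  have hq : w₁ * cs.simple s = v * cs.simple t := mul_right_cancel hv
  have hg : u * cs.simple s = v * cs.simple r := by
    have h : u * cs.simple s * cs.simple t = v * cs.simple r * cs.simple t := by
      rw [← hpu, hv, mul_assoc, ← hcomm, mul_assoc]
    exact mul_right_cancel h
  obtain ⟨y, hy, hly⟩ := cs.exists_eq_mul_wordProd_alternatingWord (i := s) (j := t) (k := 3)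
    (w := w₁ * cs.simple s)
    (by rw [isRightDescent_iff, simple_mul_simple_cancel_right]; omega)
    (by rw [isRightDescent_iff, hq, simple_mul_simple_cancel_right, ← hq]; omega)
    (by rw [hst]; simp)
  simp only [alternatingWord, List.concat_eq_append, List.nil_append, List.cons_append,
    wordProd_cons, wordProd_nil, mul_one, ← mul_assoc] at hy
  have hvy : v = y * cs.simple t * cs.simple s := mul_right_cancel (hq.symm.trans hy)
  obtain ⟨x, hx, hlx⟩ := cs.exists_eq_mul_wordProd_alternatingWord (i := s) (j := r) (k := 6)
    (w := u * cs.simple s)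
    (by rw [isRightDescent_iff, simple_mul_simple_cancel_right]; omega)
    (by rw [isRightDescent_iff, hg, simple_mul_simple_cancel_right, ← hg]; omega)
    hsr
  simp only [alternatingWord, List.concat_eq_append, List.nil_append, List.cons_append,
    wordProd_cons, wordProd_nil, mul_one, ← mul_assoc] at hx
  have hh : y * cs.simple t =
      x * cs.simple s * cs.simple r * cs.simple s * cs.simple r := by
    rw [hg, hvy] at hx
    exact mul_right_cancel (mul_right_cancel hx)
  have hyt := cs.length_mul_simple y t
  have hyts := cs.length_mul_simple (y * cs.simple t) s
  rw [← hvy] at hyts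
  have hxs := cs.length_mul_simple x s
  have hxsr := cs.length_mul_simple (x * cs.simple s) r
  have hxsrs := cs.length_mul_simple (x * cs.simple s * cs.simple r) s
  have hxsrsr := cs.length_mul_simple (x * cs.simple s * cs.simple r * cs.simple s) r
  rw [← hh] at hxsrsr
  obtain ⟨z, hz, hlz⟩ := cs.exists_eq_mul_wordProd_alternatingWord (i := t) (j := r) (k := 2)
    (w := y * cs.simple t)
    (by rw [isRightDescent_iff, simple_mul_simple_cancel_right]; omega)
    (by rw [isRightDescent_iff, hh, simple_mul_simple_cancel_right, ← hh]; omega)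
    (by rw [orderOf_comm, hrt]; simp)
  simp only [alternatingWord, List.concat_eq_append, List.nil_append, List.cons_append,
    wordProd_cons, wordProd_nil, mul_one, ← mul_assoc] at hz
  have hzt : z * cs.simple t = x * cs.simple s * cs.simple r * cs.simple s :=
    mul_right_cancel (hz.symm.trans hh)
  have hzt' := cs.length_mul_simple z t
  rw [← hzt] at hxsrsr hxsrs
  exact ih _ (by omega) hzt (by omega) rfl
    (by rw [isRightDescent_iff, simple_mul_simple_cancel_right]; omega)

end CoxeterSystem

open LaurentPolynomial

/-- Corollary 3.2: there is no `w ∈ W` with `w = (w₁)(srs) = (w₂)(t)`. -/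
theorem no_element_srs_and_t
{W : Type*} [Group W] {M : CoxeterMatrix (Fin 3)} (cs : CoxeterSystem M W)
    (r s t : W) (hr : r = cs.simple 0) (hs : s = cs.simple 1) (ht : t = cs.simple 2)
    (hrt : orderOf (r * t) = 2)
    (hst : orderOf (s * t) = 3)
    (hsr : orderOf (s * r) = 0 ∨ 7 ≤ orderOf (s * r)) :
    ¬ ∃ w w1 w2 : W,
        w = w1 * s * r * s ∧ cs.length w = cs.length w1 + 3 ∧
        w = w2 * t ∧ cs.length w = cs.length w2 + 1 := by
  subst hr hs ht
  rintro ⟨w, w₁, w₂, hw₁, hlen₁, hw₂, hlen₂⟩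
  refine cs.not_isRightDescent_of_eq_mul_simple_mul_simple_mul_simple hrt hst
    (hsr.imp_right (by omega)) hw₁ hlen₁ ?_
  rw [cs.isRightDescent_iff, hlen₂, hw₂, cs.simple_mul_simple_cancel_right]
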